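/- arXiv:1708.09664 — 2 statements merged into one kernel-verified Lean document; each statement's English description precedes it below -/
import Mathlib

section
/- Criticality via null-sequences: Let b be a connected graph over X and q : X → ℝ a potential such that h ≥ 0. Then h is critical in X if and only if for every o ∈ X and every c > 0 there exists a null-sequence (e_n) of h with e_n(o) = c for all n. -/
open Filter Topology

variable {X : Type*}

/-- A graph over `X`: symmetric, nonnegative, zero diagonal, locally summable. -/
def IsGraph (b : X → X → ℝ) : Prop :=
  (∀ x y, 0 ≤ b x y) ∧ (∀ x y, b x y = b y x) ∧ (∀ x, b x x = 0) ∧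
    ∀ x, Summable fun y => b x y

/-- Connectedness of the graph `b`: any two vertices are joined by a path of
adjacent vertices. -/
def GraphConnected (b : X → X → ℝ) : Prop :=
  ∀ x y : X, ∃ (n : ℕ) (p : ℕ → X), p 0 = x ∧ p n = y ∧ ∀ i < n, 0 < b (p i) (p (i + 1))

/-- A set `W` is connected in the graph `b` if any two of its points are joined by a
path of adjacent vertices lying in `W`. -/
def ConnectedIn (b : X → X → ℝ) (W : Set X) : Prop :=
  ∀ x ∈ W, ∀ y ∈ W, ∃ (n : ℕ) (p : ℕ → X), p 0 = x ∧ p n = y ∧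
    (∀ i ≤ n, p i ∈ W) ∧ ∀ i < n, 0 < b (p i) (p (i + 1))

/-- Local finiteness of the graph `b`. -/
def LocFin (b : X → X → ℝ) : Prop := ∀ x, {y | 0 < b x y}.Finite

/-- Membership in `F(X)`, the functions against which `b` is summable. -/
def MemF (b : X → X → ℝ) (f : X → ℝ) : Prop :=
  ∀ x, Summable fun y => b x y * |f y|

/-- The formal Schrödinger operator `H = L + q`. -/
noncomputable def Hop (b : X → X → ℝ) (q : X → ℝ) (f : X → ℝ) (x : X) : ℝ :=
  (∑' y, b x y * (f x - f y)) + q x * f x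

/-- Membership in `C_c(X)`: finitely supported functions. -/
def FinSupp (φ : X → ℝ) : Prop := (Function.support φ).Finite

/-- The energy form `h` associated with `b` and `q`, evaluated on `C_c(X)`. -/
noncomputable def hform (b : X → X → ℝ) (q : X → ℝ) (φ : X → ℝ) : ℝ :=
  (1 / 2) * (∑' p : X × X, b p.1 p.2 * (φ p.1 - φ p.2) ^ 2) + ∑' x, q x * φ x ^ 2

/-- The form `h` is subcritical in `X`. -/
def Subcritical (b : X → X → ℝ) (q : X → ℝ) : Prop :=
  ∃ w : X → ℝ, (∀ x, 0 ≤ w x) ∧ w ≠ 0 ∧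
    ∀ φ : X → ℝ, FinSupp φ → (∑' x, w x * φ x ^ 2) ≤ hform b q φ

/-- The capacity of the singleton `{x}` with respect to the form `h`. -/
noncomputable def capH (b : X → X → ℝ) (q : X → ℝ) (x : X) : ℝ :=
  sInf {r : ℝ | ∃ φ : X → ℝ, FinSupp φ ∧ φ x = 1 ∧ r = hform b q φ}

/-- The extended (extended-real-valued) energy of the weighted Laplacian part. -/
noncomputable def hExt (b : X → X → ℝ) (f : X → ℝ) : ENNReal :=
  (∑' p : X × X, ENNReal.ofReal (b p.1 p.2 * (f p.1 - f p.2) ^ 2)) / 2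

theorem FinSupp.summable_mul_sq {φ : X → ℝ} (hφ : FinSupp φ) (w : X → ℝ) :
    Summable fun x => w x * φ x ^ 2 := by
  refine summable_of_hasFiniteSupport (hφ.subset fun x hx => ?_)
  rw [Function.mem_support] at hx ⊢
  intro h
  simp [h] at hx

/-- The edge energy of a finitely supported function on a graph is summable. -/
theorem IsGraph.summable_energy {b : X → X → ℝ} (hb : IsGraph b) {φ : X → ℝ}
    (hφ : FinSupp φ) :
    Summable fun p : X × X => b p.1 p.2 * (φ p.1 - φ p.2) ^ 2 := by
  obtain ⟨hnonneg, hsymm, -, hsum⟩ := hb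
  have hfst : Summable fun p : X × X => b p.1 p.2 * φ p.1 ^ 2 := by
    rw [summable_prod_of_nonneg fun p => mul_nonneg (hnonneg p.1 p.2) (sq_nonneg (φ p.1))]
    refine ⟨fun x => (hsum x).mul_right (φ x ^ 2), ?_⟩
    simp only [tsum_mul_right]
    exact hφ.summable_mul_sq fun x => ∑' y, b x y
  have hsnd : Summable fun p : X × X => b p.1 p.2 * φ p.2 ^ 2 := by
    refine ((Equiv.prodComm X X).summable_iff.mpr hfst).congr fun p => ?_
    simp [hsymm p.1 p.2]
  refine Summable.of_nonneg_of_le (fun p => mul_nonneg (hnonneg _ _) (sq_nonneg _))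
    (fun p => ?_) ((hfst.add hsnd).mul_left 2)
  nlinarith [mul_nonneg (hnonneg p.1 p.2) (sq_nonneg (φ p.1 + φ p.2))]

theorem FinSupp.abs {φ : X → ℝ} (hφ : FinSupp φ) : FinSupp fun x => |φ x| :=
  hφ.subset fun x hx h => hx (by simp [h])

theorem FinSupp.const_mul {φ : X → ℝ} (hφ : FinSupp φ) (a : ℝ) :
    FinSupp fun x => a * φ x :=
  hφ.subset fun x hx h => hx (by simp [h])

/-- The energy form decreases under taking absolute values. -/
theorem IsGraph.hform_abs_le {b : X → X → ℝ} (hb : IsGraph b) (q : X → ℝ) {φ : X → ℝ}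
    (hφ : FinSupp φ) : hform b q (fun x => |φ x|) ≤ hform b q φ := by
  have henergy : (∑' p : X × X, b p.1 p.2 * (|φ p.1| - |φ p.2|) ^ 2) ≤
      ∑' p : X × X, b p.1 p.2 * (φ p.1 - φ p.2) ^ 2 :=
    (hb.summable_energy hφ.abs).tsum_le_tsum
      (fun p => mul_le_mul_of_nonneg_left
        (sq_le_sq.mpr (abs_abs_sub_abs_le (φ p.1) (φ p.2))) (hb.1 _ _))
      (hb.summable_energy hφ)
  simp only [hform, sq_abs]
  linarith

theorem hform_const_mul (b : X → X → ℝ) (q : X → ℝ) (a : ℝ) (φ : X → ℝ) :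
    hform b q (fun x => a * φ x) = a ^ 2 * hform b q φ := by
  have henergy : ∀ p : X × X, b p.1 p.2 * (a * φ p.1 - a * φ p.2) ^ 2 =
      a ^ 2 * (b p.1 p.2 * (φ p.1 - φ p.2) ^ 2) := fun p => by ring
  have hpot : ∀ x, q x * (a * φ x) ^ 2 = a ^ 2 * (q x * φ x ^ 2) := fun x => by ring
  simp only [hform, henergy, hpot, tsum_mul_left]
  ring

/-- A positive lower bound for the energy of the nonnegative functions with a prescribed
positive value at one vertex forces subcriticality. -/
theorem IsGraph.subcritical_of_le_hform {b : X → X → ℝ} (hb : IsGraph b) {q : X → ℝ}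
    (hpos : ∀ φ : X → ℝ, FinSupp φ → 0 ≤ hform b q φ) {o : X} {c ε : ℝ} (hc : 0 < c)
    (hε : 0 < ε)
    (hle : ∀ φ : X → ℝ, FinSupp φ → (∀ x, 0 ≤ φ x) → φ o = c → ε ≤ hform b q φ) :
    Subcritical b q := by
  classical
  refine ⟨Pi.single o (ε / c ^ 2), fun x => ?_, ?_, fun φ hφ => ?_⟩
  · exact (Pi.single_nonneg.mpr (by positivity) : (0 : X → ℝ) ≤ _) x
  · rw [Ne, Pi.single_eq_zero_iff]
    positivity
  rw [tsum_eq_single o fun x hx => by simp [Pi.single_eq_of_ne hx], Pi.single_eq_same]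
  rcases eq_or_ne (φ o) 0 with h0 | h0
  · simpa [h0] using hpos φ hφ
  have ho : 0 < |φ o| := abs_pos.mpr h0
  have hscaled := hle (fun x => c / |φ o| * |φ x|) (hφ.abs.const_mul _)
    (fun x => by positivity) (by field_simp)
  rw [hform_const_mul, div_pow, sq_abs, div_mul_eq_mul_div, le_div_iff₀ (by positivity)]
    at hscaled
  refine le_trans ?_ (hb.hform_abs_le q hφ)
  rw [div_mul_eq_mul_div, div_le_iff₀ (by positivity)]
  linarith

/-- Criticality via null-sequences. -/
theorem criticality_iff_null_sequences (b : X → X → ℝ) (q : X → ℝ) (hb : IsGraph b)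
    (hconn : GraphConnected b)
    (hpos : ∀ φ : X → ℝ, FinSupp φ → 0 ≤ hform b q φ) :
    ¬ Subcritical b q ↔
      ∀ (o : X) (c : ℝ), 0 < c →
        ∃ e : ℕ → X → ℝ, (∀ n, FinSupp (e n)) ∧ (∀ n x, 0 ≤ e n x) ∧
          (∀ n, e n o = c) ∧ Tendsto (fun n => hform b q (e n)) atTop (nhds 0) := by
  constructor
  · intro hcrit o c hc
    have hsmall : ∀ n : ℕ, ∃ φ : X → ℝ, FinSupp φ ∧ (∀ x, 0 ≤ φ x) ∧ φ o = c ∧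
        hform b q φ < 1 / ((n : ℝ) + 1) := by
      intro n
      by_contra! h
      exact hcrit (hb.subcritical_of_le_hform hpos hc (by positivity) h)
    choose e hfin hnonneg ho hlt using hsmall
    exact ⟨e, hfin, hnonneg, ho, squeeze_zero (fun n => hpos _ (hfin n))
      (fun n => (hlt n).le) tendsto_one_div_add_atTop_nhds_zero_nat⟩
  · rintro hnull ⟨w, hw, hw0, hle⟩
    obtain ⟨o, ho⟩ := Function.ne_iff.mp hw0
    obtain ⟨e, hfin, -, heo, hlim⟩ := hnull o 1 one_pos
    have hbound : ∀ n, w o ≤ hform b q (e n) := fun n => by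
      have hterm := ((hfin n).summable_mul_sq w).le_tsum o
        fun x _ => mul_nonneg (hw x) (sq_nonneg _)
      simp only [heo, one_pow, mul_one] at hterm
      exact hterm.trans (hle _ (hfin n))
    exact ho (le_antisymm (ge_of_tendsto' hlim hbound) (hw o))
end

section
/- Criticality via uniqueness of positive superharmonic functions: Let b be a connected graph over X and q : X → ℝ a potential such that h ≥ 0. Then the following are equivalent: (i) h is critical in X; (ii) there exists a positive H-superharmonic function on X and any two positive H-superharmonic functions on X are linearly dependent; (iii) there do not exist infinitely many linearly independent positive H-superharmonic functions on X. -/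
open Filter Topology

variable {X : Type*}

/-- The quadratic form of the matrix `a` on the finite set `S`. -/
def finForm (a : X → X → ℝ) (S : Finset X) (φ : X → ℝ) : ℝ :=
  ∑ x ∈ S, ∑ y ∈ S, a x y * φ x * φ y

lemma finForm_congr (a : X → X → ℝ) {S : Finset X} {φ ψ : X → ℝ} (h : ∀ x ∈ S, φ x = ψ x) :
    finForm a S φ = finForm a S ψ :=
  Finset.sum_congr rfl fun x hx => Finset.sum_congr rfl fun y hy => by rw [h x hx, h y hy]

lemma sum_mul_update [DecidableEq X] {S : Finset X} {z : X} (hz : z ∉ S) (f φ : X → ℝ) (t : ℝ) :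
    ∑ y ∈ S, f y * Function.update φ z t y = ∑ y ∈ S, f y * φ y :=
  Finset.sum_congr rfl fun y hy => by rw [Function.update_of_ne (ne_of_mem_of_not_mem hy hz)]

lemma finForm_update [DecidableEq X] (a : X → X → ℝ) {S : Finset X} {z : X} (hz : z ∉ S)
    (φ : X → ℝ) (t : ℝ) : finForm a S (Function.update φ z t) = finForm a S φ :=
  finForm_congr a fun _ hy => Function.update_of_ne (ne_of_mem_of_not_mem hy hz) _ _

lemma finForm_insert [DecidableEq X] {a : X → X → ℝ} (hsymm : ∀ x y, a x y = a y x)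
    {S : Finset X} {z : X} (hz : z ∉ S) (φ : X → ℝ) :
    finForm a (insert z S) φ =
      a z z * φ z ^ 2 + 2 * φ z * (∑ y ∈ S, a z y * φ y) + finForm a S φ := by
  unfold finForm
  rw [Finset.sum_insert hz, Finset.sum_insert hz]
  simp_rw [Finset.sum_insert hz, Finset.sum_add_distrib]
  have h1 : ∑ x ∈ S, a x z * φ x * φ z = φ z * ∑ y ∈ S, a z y * φ y := by
    rw [Finset.mul_sum]
    exact Finset.sum_congr rfl fun x _ => by rw [hsymm x z]; ring
  have h2 : ∑ y ∈ S, a z y * φ z * φ y = φ z * ∑ y ∈ S, a z y * φ y := by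
    rw [Finset.mul_sum]
    exact Finset.sum_congr rfl fun x _ => by ring
  rw [h1, h2]
  ring

lemma finForm_schur {a : X → X → ℝ} (hsymm : ∀ x y, a x y = a y x)
    (S : Finset X) (z : X) (φ : X → ℝ) :
    finForm (fun x y => a x y - a x z * a z y / a z z) S φ =
      finForm a S φ - (∑ y ∈ S, a z y * φ y) ^ 2 / a z z := by
  unfold finForm
  rw [sq, Finset.sum_mul_sum, Finset.sum_div, ← Finset.sum_sub_distrib]
  refine Finset.sum_congr rfl fun x _ => ?_
  rw [Finset.sum_div, ← Finset.sum_sub_distrib]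
  refine Finset.sum_congr rfl fun y _ => ?_
  simp only [hsymm x z]
  ring

lemma finForm_single [DecidableEq X] (a : X → X → ℝ) {S : Finset X} {z : X} (hz : z ∈ S) :
    finForm a S (Pi.single z 1) = a z z := by
  unfold finForm
  rw [Finset.sum_eq_single z, Finset.sum_eq_single z]
  · simp
  · intro y _ hy; simp [hy]
  · exact fun h => absurd hz h
  · intro y _ hy; simp [hy]
  · exact fun h => absurd hz h

/-- In a positive semidefinite matrix, a row with vanishing diagonal entry vanishes. -/
lemma eq_zero_of_diag_eq_zero [DecidableEq X] {a : X → X → ℝ} (hsymm : ∀ x y, a x y = a y x)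
    {S : Finset X} {z : X} (hz : z ∉ S) (hpos : ∀ φ, 0 ≤ finForm a (insert z S) φ)
    (hzz : a z z = 0) {y : X} (hy : y ∈ S) : a z y = 0 := by
  have hyz : y ≠ z := fun h => hz (h ▸ hy)
  have key : ∀ t : ℝ, 0 ≤ 2 * t * a z y + a y y := by
    intro t
    have h := hpos (Function.update (Pi.single y 1) z t)
    rw [finForm_insert hsymm hz, finForm_update a hz, finForm_single a hy, hzz,
      sum_mul_update hz, Function.update_self,
      Finset.sum_eq_single y (fun x _ hx => by simp [hx]) (fun h => absurd hy h)] at h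
    simpa using h
  by_contra hne
  have h := key (-(a y y + 1) / (2 * a z y))
  have : 2 * (-(a y y + 1) / (2 * a z y)) * a z y = -(a y y + 1) := by field_simp
  linarith

/-- A positive semidefinite symmetric matrix with nonpositive off-diagonal entries admits a
nonnegative supersolution normalized at a prescribed index. -/
lemma exists_finite_supersolution [DecidableEq X] (o : X) (K : Finset X) (ho : o ∉ K) :
    ∀ a : X → X → ℝ, (∀ x y, a x y = a y x) → (∀ x y, x ≠ y → a x y ≤ 0) →
      (∀ φ, 0 ≤ finForm a (insert o K) φ) →
      ∃ u : X → ℝ, (∀ x, 0 ≤ u x) ∧ u o = 1 ∧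
        ∀ x ∈ insert o K, 0 ≤ ∑ y ∈ insert o K, a x y * u y := by
  induction K using Finset.induction_on with
  | empty =>
    intro a _ _ hpos
    refine ⟨Pi.single o 1, fun x => ?_, by simp, ?_⟩
    · by_cases h : x = o
      · subst h; simp
      · simp [h]
    · have := hpos (Pi.single o 1)
      rw [finForm_single a (by simp)] at this
      simpa using this
  | insert z K hzK ih =>
    intro a hsymm hoff hpos
    rw [Finset.mem_insert, not_or] at ho
    have hz : z ∉ insert o K := by
      rw [Finset.mem_insert, not_or]; exact ⟨Ne.symm ho.1, hzK⟩
    rw [Finset.insert_comm] at hpos ⊢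
    set S := insert o K with hS
    have hzz : 0 ≤ a z z := by
      have := hpos (Pi.single z 1)
      rwa [finForm_single a (Finset.mem_insert_self z S)] at this
    have hoff' : ∀ x y, x ≠ y → a x y - a x z * a z y / a z z ≤ 0 := by
      intro x y hxy
      rcases eq_or_ne x z with rfl | hx
      · rcases eq_or_ne (a x x) 0 with h0 | h0
        · simpa [h0] using hoff x y hxy
        · simp [h0]
      rcases eq_or_ne y z with rfl | hy
      · rcases eq_or_ne (a y y) 0 with h0 | h0
        · simpa [h0] using hoff x y hxy
        · simp [h0]
      have h1 : 0 ≤ a x z * a z y / a z z :=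
        div_nonneg (mul_nonneg_of_nonpos_of_nonpos (hoff x z hx) (hoff z y hy.symm)) hzz
      linarith [hoff x y hxy]
    have hpos' : ∀ φ, 0 ≤ finForm (fun x y => a x y - a x z * a z y / a z z) S φ := by
      intro φ
      rw [finForm_schur hsymm]
      have h := hpos (Function.update φ z (-(∑ y ∈ S, a z y * φ y) / a z z))
      rw [finForm_insert hsymm hz, finForm_update a hz, sum_mul_update hz, Function.update_self] at h
      refine h.trans_eq ?_
      rcases eq_or_ne (a z z) 0 with h0 | h0
      · simp [h0]
      · field_simp; ring
    obtain ⟨u, hu0, huo, hu⟩ := ih ho.2 (fun x y => a x y - a x z * a z y / a z z)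
      (fun x y => by simp only [hsymm x y, hsymm x z, hsymm z y]; ring) hoff' hpos'
    have hL : ∑ y ∈ S, a z y * u y ≤ 0 := Finset.sum_nonpos fun y hy =>
      mul_nonpos_of_nonpos_of_nonneg (hoff z y (ne_of_mem_of_not_mem hy hz).symm) (hu0 y)
    refine ⟨Function.update u z (-(∑ y ∈ S, a z y * u y) / a z z), fun x => ?_, ?_, ?_⟩
    · rcases eq_or_ne x z with rfl | hx
      · rw [Function.update_self]; exact div_nonneg (by linarith) hzz
      · rw [Function.update_of_ne hx]; exact hu0 x
    · rwa [Function.update_of_ne ho.1]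
    · intro x hx
      rw [Finset.sum_insert hz, Function.update_self, sum_mul_update hz]
      rcases Finset.mem_insert.1 hx with rfl | hxS
      · rcases eq_or_ne (a x x) 0 with h0 | h0
        · have hL0 : ∑ y ∈ S, a x y * u y = 0 := Finset.sum_eq_zero fun y hy => by
            rw [eq_zero_of_diag_eq_zero hsymm hz hpos h0 hy, zero_mul]
          simp [hL0]
        · rw [mul_div_cancel₀ _ h0]; simp
      · refine (hu x hxS).trans_eq ?_
        simp_rw [sub_mul, Finset.sum_sub_distrib]
        have : ∑ y ∈ S, a x z * a z y / a z z * u y =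
            a x z * (∑ y ∈ S, a z y * u y) / a z z := by
          rw [Finset.mul_sum, Finset.sum_div]
          exact Finset.sum_congr rfl fun y _ => by ring
        rw [this]; ring

/-- The diagonal coefficient `∑ y, b x y + q x` of the Schrödinger operator. -/
noncomputable def diagCoeff (b : X → X → ℝ) (q : X → ℝ) (x : X) : ℝ := (∑' y, b x y) + q x

open Classical in
/-- The matrix of the Schrödinger operator. -/
noncomputable def schrodingerMatrix (b : X → X → ℝ) (q : X → ℝ) (x y : X) : ℝ :=
  (if x = y then diagCoeff b q x else 0) - b x y

lemma sum_schrodingerMatrix_mul (b : X → X → ℝ) (q u : X → ℝ) {S : Finset X} {x : X}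
    (hx : x ∈ S) :
    ∑ y ∈ S, schrodingerMatrix b q x y * u y = diagCoeff b q x * u x - ∑ y ∈ S, b x y * u y := by
  classical
  simp [schrodingerMatrix, sub_mul, Finset.sum_sub_distrib, hx]

lemma finForm_schrodingerMatrix (b : X → X → ℝ) (q φ : X → ℝ) (S : Finset X) :
    finForm (schrodingerMatrix b q) S φ =
      ∑ x ∈ S, diagCoeff b q x * φ x ^ 2 - ∑ x ∈ S, ∑ y ∈ S, b x y * φ x * φ y := by
  unfold finForm
  rw [← Finset.sum_sub_distrib]
  refine Finset.sum_congr rfl fun x hx => ?_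
  have h := congrArg (φ x * ·) (sum_schrodingerMatrix_mul b q φ hx)
  simp only [Finset.mul_sum, mul_sub] at h
  rw [Finset.sum_congr rfl fun y _ => show schrodingerMatrix b q x y * φ x * φ y =
    φ x * (schrodingerMatrix b q x y * φ y) by ring, h]
  congr 1
  · ring
  · exact Finset.sum_congr rfl fun y _ => by ring

lemma hasSum_mul_fst_sq {b : X → X → ℝ} (hb : IsGraph b) {φ : X → ℝ} {S : Finset X}
    (hφ : ∀ x ∉ S, φ x = 0) :
    HasSum (fun p : X × X => b p.1 p.2 * φ p.1 ^ 2) (∑ x ∈ S, (∑' y, b x y) * φ x ^ 2) := by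
  have hzero : ∀ x ∉ S, ∑' y, b x y * φ x ^ 2 = 0 := fun x hx => by simp [hφ x hx]
  have hfst : ∀ x, Summable fun y => b x y * φ x ^ 2 := fun x => (hb.2.2.2 x).mul_right _
  have hsnd : Summable fun x => ∑' y, b x y * φ x ^ 2 := summable_of_ne_finset_zero hzero
  have hnn : 0 ≤ fun p : X × X => b p.1 p.2 * φ p.1 ^ 2 :=
    fun p => mul_nonneg (hb.1 _ _) (sq_nonneg _)
  have hsum : Summable fun p : X × X => b p.1 p.2 * φ p.1 ^ 2 :=
    (summable_prod_of_nonneg hnn).2 ⟨hfst, hsnd⟩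
  have heq : ∑' p : X × X, b p.1 p.2 * φ p.1 ^ 2 = ∑ x ∈ S, (∑' y, b x y) * φ x ^ 2 := by
    rw [hsum.tsum_prod, tsum_eq_sum hzero]
    exact Finset.sum_congr rfl fun x _ => tsum_mul_right
  rw [← heq]
  exact hsum.hasSum

lemma hform_eq_finForm {b : X → X → ℝ} (hb : IsGraph b) (q : X → ℝ) {φ : X → ℝ} {S : Finset X}
    (hφ : ∀ x ∉ S, φ x = 0) : hform b q φ = finForm (schrodingerMatrix b q) S φ := by
  have h1 := hasSum_mul_fst_sq hb hφ
  have h2 : HasSum (fun p : X × X => b p.1 p.2 * φ p.2 ^ 2) (∑ x ∈ S, (∑' y, b x y) * φ x ^ 2) := by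
    refine ((Equiv.prodComm X X).hasSum_iff.2 h1).congr_fun fun p => ?_
    simp [hb.2.1 p.2 p.1]
  have h3 : HasSum (fun p : X × X => b p.1 p.2 * φ p.1 * φ p.2)
      (∑ x ∈ S, ∑ y ∈ S, b x y * φ x * φ y) := by
    rw [← Finset.sum_product']
    refine hasSum_sum_of_ne_finset_zero fun p hp => ?_
    rw [Finset.mem_product, not_and_or] at hp
    rcases hp with hp | hp <;> simp [hφ _ hp]
  have h4 : ∑' p : X × X, b p.1 p.2 * (φ p.1 - φ p.2) ^ 2 =
      2 * (∑ x ∈ S, (∑' y, b x y) * φ x ^ 2) - 2 * ∑ x ∈ S, ∑ y ∈ S, b x y * φ x * φ y := by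
    rw [two_mul (∑ x ∈ S, _)]
    refine (((h1.add h2).sub (h3.mul_left 2)).congr_fun fun p => ?_).tsum_eq
    ring
  have h5 : ∑' x, q x * φ x ^ 2 = ∑ x ∈ S, q x * φ x ^ 2 :=
    tsum_eq_sum fun x hx => by simp [hφ x hx]
  rw [hform, h4, h5, finForm_schrodingerMatrix]
  simp only [diagCoeff, add_mul, Finset.sum_add_distrib]
  ring

lemma MemF.summable {b : X → X → ℝ} (hb : IsGraph b) {u : X → ℝ} (hu : MemF b u) (x : X) :
    Summable fun y => b x y * u y :=
  .of_norm <| (hu x).congr fun y => by rw [norm_mul, Real.norm_of_nonneg (hb.1 x y), Real.norm_eq_abs]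

lemma Hop_eq {b : X → X → ℝ} (hb : IsGraph b) (q : X → ℝ) {u : X → ℝ} (hu : MemF b u) (x : X) :
    Hop b q u x = diagCoeff b q x * u x - ∑' y, b x y * u y := by
  have h : ∑' y, b x y * (u x - u y) = (∑' y, b x y) * u x - ∑' y, b x y * u y := by
    rw [← tsum_mul_right, ← ((hb.2.2.2 x).mul_right (u x)).tsum_sub (hu.summable hb x)]
    exact tsum_congr fun y => mul_sub _ _ _
  rw [Hop, h, diagCoeff]
  ring

/-- `u` is a positive `H`-superharmonic function. -/
def IsPosSuperharmonic (b : X → X → ℝ) (q u : X → ℝ) : Prop :=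
  MemF b u ∧ (∀ x, 0 ≤ u x) ∧ u ≠ 0 ∧ ∀ x, 0 ≤ Hop b q u x

lemma GraphConnected.induction {b : X → X → ℝ} (hconn : GraphConnected b) {P : X → Prop} {o : X}
    (ho : P o) (step : ∀ x y, 0 < b x y → P x → P y) (y : X) : P y := by
  obtain ⟨n, p, rfl, rfl, hp⟩ := hconn o y
  have : ∀ i ≤ n, P (p i) := by
    intro i
    induction i with
    | zero => exact fun _ => ho
    | succ i ih => exact fun hi => step _ _ (hp i hi) (ih (by omega))
  exact this n le_rfl

lemma IsPosSuperharmonic.of_sum_le {b : X → X → ℝ} (hb : IsGraph b) {q u : X → ℝ}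
    (hu0 : ∀ x, 0 ≤ u x) (hne : u ≠ 0)
    (h : ∀ x (F : Finset X), ∑ y ∈ F, b x y * u y ≤ diagCoeff b q x * u x) :
    IsPosSuperharmonic b q u := by
  have hnn : ∀ x, 0 ≤ fun y => b x y * u y := fun x y => mul_nonneg (hb.1 x y) (hu0 y)
  have hF : MemF b u := fun x => by
    simp_rw [abs_of_nonneg (hu0 _)]
    exact summable_of_sum_le (hnn x) (h x)
  refine ⟨hF, hu0, hne, fun x => ?_⟩
  rw [Hop_eq hb q hF]
  exact sub_nonneg.2 (Real.tsum_le_of_sum_le (hnn x) (h x))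

/-- If the energy form is nonnegative, there are approximate supersolutions on finite sets. -/
lemma exists_approx_supersolution {b : X → X → ℝ} (hb : IsGraph b) {q : X → ℝ}
    (hpos : ∀ φ : X → ℝ, FinSupp φ → 0 ≤ hform b q φ) (o : X) (K : Finset X) (hK : o ∈ K) :
    ∃ u : X → ℝ, (∀ x, 0 ≤ u x) ∧ u o = 1 ∧
      ∀ x ∈ K, ∑ y ∈ K, b x y * u y ≤ diagCoeff b q x * u x := by
  classical
  have hsymm : ∀ x y, schrodingerMatrix b q x y = schrodingerMatrix b q y x := fun x y => by
    rcases eq_or_ne x y with rfl | h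
    · rfl
    · simp [schrodingerMatrix, h, h.symm, hb.2.1 x y]
  have hoff : ∀ x y, x ≠ y → schrodingerMatrix b q x y ≤ 0 := fun x y hxy => by
    simpa [schrodingerMatrix, hxy] using hb.1 x y
  have hform_nonneg : ∀ φ, 0 ≤ finForm (schrodingerMatrix b q) K φ := fun φ => by
    have hsupp : ∀ x ∉ K, (if x ∈ K then φ x else 0) = 0 := fun x hx => if_neg hx
    rw [← finForm_congr (φ := fun x => if x ∈ K then φ x else 0) _ fun x hx => if_pos hx,
      ← hform_eq_finForm hb q hsupp]
    exact hpos _ (K.finite_toSet.subset fun x hx => by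
      by_contra h; exact hx (hsupp x h))
  have hins : insert o (K.erase o) = K := Finset.insert_erase hK
  obtain ⟨u, hu0, huo, hu⟩ := exists_finite_supersolution o (K.erase o) (Finset.notMem_erase o K)
    (schrodingerMatrix b q) hsymm hoff (hins.symm ▸ hform_nonneg)
  refine ⟨u, hu0, huo, fun x hx => ?_⟩
  rw [hins] at hu
  have h := hu x hx
  rw [sum_schrodingerMatrix_mul b q u hx] at h
  linarith

/-- Existence of a positive superharmonic function (Allegretto–Piepenbrink). -/
lemma exists_isPosSuperharmonic {b : X → X → ℝ} (hb : IsGraph b) (hconn : GraphConnected b)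
    {q : X → ℝ} (hpos : ∀ φ : X → ℝ, FinSupp φ → 0 ≤ hform b q φ) (o : X) :
    ∃ u, IsPosSuperharmonic b q u := by
  classical
  choose v hv0 hvo hv using fun K : Finset X =>
    exists_approx_supersolution hb hpos o (insert o K) (Finset.mem_insert_self o K)
  have hev : ∀ x (F : Finset X), ∀ᶠ K in atTop,
      ∑ y ∈ F, b x y * v K y ≤ diagCoeff b q x * v K x := by
    intro x F
    filter_upwards [eventually_ge_atTop (insert x F)] with K hK
    have hsub : insert x F ⊆ insert o K := hK.trans (Finset.subset_insert o K)
    refine le_trans (Finset.sum_le_sum_of_subset_of_nonneg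
      ((Finset.subset_insert x F).trans hsub) fun y _ _ => mul_nonneg (hb.1 x y) (hv0 K y)) ?_
    exact hv K x (hsub (Finset.mem_insert_self x F))
  have hbdd : ∀ y, ∃ C, ∀ᶠ K in atTop, v K y ≤ C := by
    refine hconn.induction (o := o) ⟨1, .of_forall fun K => (hvo K).le⟩ ?_
    rintro x y hxy ⟨C, hC⟩
    refine ⟨|diagCoeff b q x| * C / b x y, ?_⟩
    filter_upwards [hC, hev x {y}] with K hK hK'
    rw [Finset.sum_singleton] at hK'
    rw [le_div_iff₀ hxy, mul_comm]
    calc b x y * v K y ≤ diagCoeff b q x * v K x := hK'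
      _ ≤ |diagCoeff b q x| * v K x := mul_le_mul_of_nonneg_right (le_abs_self _) (hv0 K x)
      _ ≤ _ := mul_le_mul_of_nonneg_left hK (abs_nonneg _)
  let 𝒰 : Ultrafilter (Finset X) := Ultrafilter.of atTop
  have h𝒰 : (𝒰 : Filter (Finset X)) ≤ atTop := Ultrafilter.of_le atTop
  have hlim : ∀ y, ∃ l, Tendsto (fun K => v K y) 𝒰 (𝓝 l) := by
    intro y
    obtain ⟨C, hC⟩ := hbdd y
    obtain ⟨l, -, hl⟩ := (isCompact_Icc (a := (0 : ℝ)) (b := C)).ultrafilter_le_nhds'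
      (𝒰.map fun K => v K y) ((hC.filter_mono h𝒰).mono fun K hK => ⟨hv0 K y, hK⟩)
    exact ⟨l, hl⟩
  choose u hu using hlim
  have hu0 : ∀ x, 0 ≤ u x := fun x => ge_of_tendsto' (hu x) fun K => hv0 K x
  have huo : u o = 1 := tendsto_nhds_unique (hu o) (by simp [hvo])
  refine ⟨u, .of_sum_le hb hu0 (fun h => by simp [h] at huo) fun x F => ?_⟩
  exact le_of_tendsto_of_tendsto (tendsto_finsetSum F fun y _ => (hu y).const_mul _)
    ((hu x).const_mul _) ((hev x F).filter_mono h𝒰)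

/-- Minimum principle: a nonnegative superharmonic function with a zero vanishes identically. -/
lemma eq_zero_of_superharmonic {b : X → X → ℝ} (hb : IsGraph b) (hconn : GraphConnected b)
    {q u : X → ℝ} (hF : MemF b u) (hu0 : ∀ x, 0 ≤ u x) (hu : ∀ x, 0 ≤ Hop b q u x) {o : X}
    (ho : u o = 0) (x : X) : u x = 0 := by
  refine hconn.induction (P := fun x => u x = 0) ho (fun x y hxy hx => ?_) x
  have h := hu x
  rw [Hop_eq hb q hF, hx, mul_zero, zero_sub, neg_nonneg] at h
  have hle := (hF.summable hb x).le_tsum y fun z _ => mul_nonneg (hb.1 x z) (hu0 z)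
  have hy : b x y * u y = 0 := le_antisymm (hle.trans h) (mul_nonneg (hb.1 x y) (hu0 y))
  exact (mul_eq_zero.1 hy).resolve_left hxy.ne'

lemma IsPosSuperharmonic.pos {b : X → X → ℝ} (hb : IsGraph b) (hconn : GraphConnected b)
    {q u : X → ℝ} (hu : IsPosSuperharmonic b q u) (x : X) : 0 < u x :=
  (hu.2.1 x).lt_of_ne fun h => hu.2.2.1 <| funext <|
    eq_zero_of_superharmonic hb hconn hu.1 hu.2.1 hu.2.2.2 h.symm

/-- The Hardy inequality associated with a positive superharmonic function. -/
lemma IsPosSuperharmonic.tsum_le_hform {b : X → X → ℝ} (hb : IsGraph b)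
    (hconn : GraphConnected b) {q u : X → ℝ} (hu : IsPosSuperharmonic b q u) {φ : X → ℝ}
    (hφ : FinSupp φ) : ∑' x, Hop b q u x / u x * φ x ^ 2 ≤ hform b q φ := by
  have hpos := hu.pos hb hconn
  have hS : ∀ x ∉ hφ.toFinset, φ x = 0 := fun x hx => by
      simpa [Function.mem_support] using mt hφ.mem_toFinset.2 hx
  set S := hφ.toFinset
  rw [tsum_eq_sum fun x hx => by simp [hS x hx], hform_eq_finForm hb q hS,
    finForm_schrodingerMatrix]
  have h1 : ∑ x ∈ S, ∑ y ∈ S, b x y * φ x * φ y ≤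
      ∑ x ∈ S, ∑ y ∈ S, b x y * u y * (φ x ^ 2 / u x) := by
    have hswap : ∑ x ∈ S, ∑ y ∈ S, b x y * u x * (φ y ^ 2 / u y) =
        ∑ x ∈ S, ∑ y ∈ S, b x y * u y * (φ x ^ 2 / u x) := by
      rw [Finset.sum_comm]
      exact Finset.sum_congr rfl fun x _ => Finset.sum_congr rfl fun y _ => by rw [hb.2.1]
    have hle : 2 * ∑ x ∈ S, ∑ y ∈ S, b x y * φ x * φ y ≤
        ∑ x ∈ S, ∑ y ∈ S, b x y * u y * (φ x ^ 2 / u x) +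
          ∑ x ∈ S, ∑ y ∈ S, b x y * u x * (φ y ^ 2 / u y) := by
      simp only [Finset.mul_sum, ← Finset.sum_add_distrib]
      refine Finset.sum_le_sum fun x _ => Finset.sum_le_sum fun y _ => ?_
      have hx := hpos x
      have hy := hpos y
      have hid : b x y * u y * (φ x ^ 2 / u x) + b x y * u x * (φ y ^ 2 / u y) -
          2 * (b x y * φ x * φ y) = b x y * (u x * u y * (φ x / u x - φ y / u y) ^ 2) := by
        field_simp
        ring
      have : 0 ≤ b x y * (u x * u y * (φ x / u x - φ y / u y) ^ 2) :=
        mul_nonneg (hb.1 x y) (by positivity)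
      linarith
    linarith
  refine le_trans ?_ (sub_le_sub_left h1 _)
  rw [← Finset.sum_sub_distrib]
  refine Finset.sum_le_sum fun x _ => ?_
  have hx := hpos x
  have hle : ∑ y ∈ S, b x y * u y ≤ ∑' y, b x y * u y :=
    (hu.1.summable hb x).sum_le_tsum S fun y _ => mul_nonneg (hb.1 x y) (hu.2.1 y)
  have hid : Hop b q u x / u x * φ x ^ 2 =
      diagCoeff b q x * φ x ^ 2 - (∑' y, b x y * u y) * (φ x ^ 2 / u x) := by
    rw [Hop_eq hb q hu.1]
    field_simp
  rw [hid, ← Finset.sum_mul]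
  exact sub_le_sub_left (mul_le_mul_of_nonneg_right hle (by positivity)) _

/-- In the critical case, positive superharmonic functions are harmonic. -/
lemma IsPosSuperharmonic.Hop_eq_zero {b : X → X → ℝ} (hb : IsGraph b) (hconn : GraphConnected b)
    {q u : X → ℝ} (hcrit : ¬ Subcritical b q) (hu : IsPosSuperharmonic b q u) (x : X) :
    Hop b q u x = 0 := by
  by_contra hne
  refine hcrit ⟨fun x => Hop b q u x / u x, fun x => div_nonneg (hu.2.2.2 x) (hu.2.1 x),
    fun h => ?_, fun φ hφ => hu.tsum_le_hform hb hconn hφ⟩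
  exact div_ne_zero hne (hu.pos hb hconn x).ne' (congrFun h x)

lemma MemF.sub {b : X → X → ℝ} (hb : IsGraph b) {u v : X → ℝ} (hu : MemF b u) (hv : MemF b v) :
    MemF b (u - v) := fun x =>
  .of_nonneg_of_le (fun y => mul_nonneg (hb.1 x y) (abs_nonneg _))
    (fun y => (mul_le_mul_of_nonneg_left (abs_sub (u y) (v y)) (hb.1 x y)).trans_eq (mul_add _ _ _))
    ((hu x).add (hv x))

lemma Hop_sub {b : X → X → ℝ} (hb : IsGraph b) {q u v : X → ℝ} (hu : MemF b u) (hv : MemF b v)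
    (x : X) : Hop b q (u - v) x = Hop b q u x - Hop b q v x := by
  rw [Hop_eq hb q hu, Hop_eq hb q hv, Hop_eq hb q (hu.sub hb hv)]
  simp only [Pi.sub_apply, mul_sub]
  rw [(hu.summable hb x).tsum_sub (hv.summable hb x)]
  ring

lemma IsPosSuperharmonic.smul {b : X → X → ℝ} (hb : IsGraph b) {q u : X → ℝ}
    (hu : IsPosSuperharmonic b q u) {c : ℝ} (hc : 0 < c) : IsPosSuperharmonic b q (c • u) := by
  have hF : MemF b (c • u) := fun x => ((hu.1 x).mul_left |c|).congr fun y => by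
    simp only [Pi.smul_apply, smul_eq_mul, abs_mul]; ring
  refine ⟨hF, fun x => mul_nonneg hc.le (hu.2.1 x), smul_ne_zero hc.ne' hu.2.2.1, fun x => ?_⟩
  have h : Hop b q (c • u) x = c * Hop b q u x := by
    rw [Hop_eq hb q hF, Hop_eq hb q hu.1, mul_sub, ← tsum_mul_left]
    simp only [Pi.smul_apply, smul_eq_mul]
    congr 1
    · ring
    · exact tsum_congr fun y => by ring
  rw [h]
  exact mul_nonneg hc.le (hu.2.2.2 x)

lemma IsPosSuperharmonic.inf {b : X → X → ℝ} (hb : IsGraph b) (hconn : GraphConnected b)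
    {q u v : X → ℝ} (hu : IsPosSuperharmonic b q u) (hv : IsPosSuperharmonic b q v) [Nonempty X] :
    IsPosSuperharmonic b q (u ⊓ v) := by
  have hpos : ∀ x, 0 < (u ⊓ v) x := fun x => lt_inf_iff.2 ⟨hu.pos hb hconn x, hv.pos hb hconn x⟩
  have key : ∀ w, IsPosSuperharmonic b q w → u ⊓ v ≤ w → ∀ x (F : Finset X), (u ⊓ v) x = w x →
      ∑ y ∈ F, b x y * (u ⊓ v) y ≤ diagCoeff b q x * (u ⊓ v) x := by
    intro w hw hle x F hx
    have h1 : ∑ y ∈ F, b x y * (u ⊓ v) y ≤ ∑ y ∈ F, b x y * w y :=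
      Finset.sum_le_sum fun y _ => mul_le_mul_of_nonneg_left (hle y) (hb.1 x y)
    have h2 : ∑ y ∈ F, b x y * w y ≤ ∑' y, b x y * w y :=
      (hw.1.summable hb x).sum_le_tsum F fun y _ => mul_nonneg (hb.1 x y) (hw.2.1 y)
    have h3 := hw.2.2.2 x
    rw [Hop_eq hb q hw.1] at h3
    rw [hx]
    linarith
  refine .of_sum_le hb (fun x => (hpos x).le) (fun h => ?_) fun x F => ?_
  · obtain ⟨x⟩ := ‹Nonempty X›
    exact (hpos x).ne' (congrFun h x)
  · rcases le_total (u x) (v x) with h | h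
    · exact key u hu inf_le_left x F (inf_eq_left.2 h)
    · exact key v hv inf_le_right x F (inf_eq_right.2 h)

/-- If all positive superharmonic functions are harmonic, they are determined up to a multiple. -/
lemma IsPosSuperharmonic.exists_eq_mul {b : X → X → ℝ} (hb : IsGraph b) (hconn : GraphConnected b)
    [Nonempty X] {q u v : X → ℝ}
    (hharm : ∀ w, IsPosSuperharmonic b q w → ∀ x, Hop b q w x = 0)
    (hu : IsPosSuperharmonic b q u) (hv : IsPosSuperharmonic b q v) :
    ∃ c : ℝ, ∀ x, v x = c * u x := by
  obtain ⟨o⟩ := ‹Nonempty X›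
  have huo := hu.pos hb hconn o
  have hcu := hu.smul hb (div_pos (hv.pos hb hconn o) huo)
  set c := v o / u o
  have ho : (c • u) o = v o := div_mul_cancel₀ _ huo.ne'
  have : Nonempty X := ⟨o⟩
  have hm := hcu.inf hb hconn hv
  have key : ∀ w, IsPosSuperharmonic b q w → c • u ⊓ v ≤ w → (c • u ⊓ v) o = w o →
      ∀ x, w x = (c • u ⊓ v) x := by
    intro w hw hle hwo x
    refine sub_eq_zero.1 (eq_zero_of_superharmonic (q := q) (u := w - c • u ⊓ v) hb hconn
      (hw.1.sub hb hm.1) (fun x => sub_nonneg.2 (hle x)) (fun x => ?_) (o := o) ?_ x)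
    · rw [Hop_sub hb hw.1 hm.1, hharm w hw, hharm _ hm, sub_zero]
    · simp [hwo]
  refine ⟨c, fun x => ?_⟩
  rw [key v hv inf_le_right (by simp [← ho]) x, ← key (c • u) hcu inf_le_left (by simp [← ho]) x]
  rfl

lemma memF_single [DecidableEq X] (b : X → X → ℝ) (o : X) (ε : ℝ) :
    MemF b (Pi.single o ε) := fun x =>
  summable_of_ne_finset_zero (s := {o}) fun y hy => by
    simp [Pi.single_eq_of_ne (Finset.notMem_singleton.1 hy)]

lemma Hop_single [DecidableEq X] {b : X → X → ℝ} (hb : IsGraph b) (q : X → ℝ) (o : X) (ε : ℝ)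
    (x : X) : Hop b q (Pi.single o ε) x =
      diagCoeff b q x * (Pi.single o ε : X → ℝ) x - b x o * ε := by
  rw [Hop_eq hb q (memF_single b o ε), tsum_eq_single o fun y hy => by simp [hy]]
  simp

/-- Strict superharmonicity at `x` allows to lower the function at `x`. -/
lemma IsPosSuperharmonic.sub_single [DecidableEq X] {b : X → X → ℝ} (hb : IsGraph b) {q u : X → ℝ}
    (hu : IsPosSuperharmonic b q u) {x : X} (hx : 0 < Hop b q u x) :
    ∃ ε > 0, IsPosSuperharmonic b q (u - Pi.single x ε) ∧
      ∀ y, 0 < b x y → 0 < Hop b q (u - Pi.single x ε) y := by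
  have hd : 0 < diagCoeff b q x * u x := by
    have h := hx
    rw [Hop_eq hb q hu.1] at h
    have : 0 ≤ ∑' y, b x y * u y := tsum_nonneg fun y => mul_nonneg (hb.1 x y) (hu.2.1 y)
    linarith
  have hux : 0 < u x := (hu.2.1 x).lt_of_ne fun h => by simp [← h] at hd
  have hdx : 0 < diagCoeff b q x := pos_of_mul_pos_left hd hux.le
  have hle : Hop b q u x ≤ diagCoeff b q x * u x := by
    rw [Hop_eq hb q hu.1]
    exact sub_le_self _ (tsum_nonneg fun y => mul_nonneg (hb.1 x y) (hu.2.1 y))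
  set ε := Hop b q u x / (2 * diagCoeff b q x) with hε
  have hε0 : 0 < ε := by positivity
  have hεd : diagCoeff b q x * ε = Hop b q u x / 2 := by rw [hε]; field_simp
  have hεu : ε < u x := by
    refine lt_of_mul_lt_mul_left ?_ hdx.le
    linarith
  have hF := memF_single b x ε
  have hne : ∀ y, y ≠ x → Hop b q (u - Pi.single x ε) y = Hop b q u y + b y x * ε := fun y hy => by
    rw [Hop_sub hb hu.1 hF, Hop_single hb, Pi.single_eq_of_ne hy]; ring
  refine ⟨ε, hε0, ⟨hu.1.sub hb hF, fun y => ?_, fun h => ?_, fun y => ?_⟩, fun y hy => ?_⟩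
  · rcases eq_or_ne y x with rfl | hy
    · simpa using hεu.le
    · simpa [hy] using hu.2.1 y
  · have := congrFun h x
    simp only [Pi.sub_apply, Pi.single_eq_same, Pi.zero_apply] at this
    linarith
  · rcases eq_or_ne y x with rfl | hy
    · rw [Hop_sub hb hu.1 hF, Hop_single hb, Pi.single_eq_same, hεd, hb.2.2.1]
      linarith
    · rw [hne y hy]
      exact add_nonneg (hu.2.2.2 y) (mul_nonneg (hb.1 y x) hε0.le)
  · have hyx : y ≠ x := fun h => by rw [h, hb.2.2.1] at hy; exact hy.false
    rw [hne y hyx]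
    exact add_pos_of_nonneg_of_pos (hu.2.2.2 y) (mul_pos (hb.2.1 x y ▸ hy) hε0)

/-- In the subcritical case, there is a strictly superharmonic function at some vertex. -/
lemma Subcritical.exists_Hop_pos {b : X → X → ℝ} (hb : IsGraph b) (hconn : GraphConnected b)
    {q : X → ℝ} (hsub : Subcritical b q) :
    ∃ o u, IsPosSuperharmonic b q u ∧ 0 < Hop b q u o := by
  classical
  obtain ⟨w, hw0, hw, hle⟩ := hsub
  obtain ⟨o, ho⟩ := Function.ne_iff.1 hw
  have hwo : 0 < w o := (hw0 o).lt_of_ne (Ne.symm ho)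
  have hpos : ∀ φ : X → ℝ, FinSupp φ → 0 ≤ hform b (q - Pi.single o (w o)) φ := by
    intro φ hφ
    have hS : ∀ x ∉ hφ.toFinset, φ x = 0 := fun x hx => by
      simpa [Function.mem_support] using mt hφ.mem_toFinset.2 hx
    have hsum : ∀ r : X → ℝ, Summable fun x => r x * φ x ^ 2 := fun r =>
      summable_of_ne_finset_zero (s := hφ.toFinset) fun x hx => by simp [hS x hx]
    have h1 : w o * φ o ^ 2 ≤ ∑' x, w x * φ x ^ 2 :=
      (hsum w).le_tsum o fun x _ => mul_nonneg (hw0 x) (sq_nonneg _)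
    have h2 : ∑' x, (q - Pi.single o (w o) : X → ℝ) x * φ x ^ 2 =
        ∑' x, q x * φ x ^ 2 - w o * φ o ^ 2 := by
      simp only [Pi.sub_apply, sub_mul]
      rw [(hsum q).tsum_sub (hsum _), tsum_eq_single (f := fun x =>
        (Pi.single o (w o) : X → ℝ) x * φ x ^ 2) o fun y hy => by simp [hy]]
      simp
    have h3 := hle φ hφ
    rw [hform] at h3 ⊢
    rw [h2]
    linarith
  obtain ⟨u, hu⟩ := exists_isPosSuperharmonic hb hconn hpos o
  have hH : ∀ x, Hop b q u x =
      Hop b (q - Pi.single o (w o)) u x + (Pi.single o (w o) : X → ℝ) x * u x := fun x => by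
    simp only [Hop, Pi.sub_apply]; ring
  have hsingle : ∀ x, 0 ≤ (Pi.single o (w o) : X → ℝ) x := 
    Pi.le_def.1 (show (0 : X → ℝ) ≤ Pi.single o (w o) from Pi.single_nonneg.2 (hw0 o))
  refine ⟨o, u, ⟨hu.1, hu.2.1, hu.2.2.1, fun x => ?_⟩, ?_⟩
  · rw [hH]
    exact add_nonneg (hu.2.2.2 x) (mul_nonneg (hsingle x) (hu.2.1 x))
  · rw [hH, Pi.single_eq_same]
    exact add_pos_of_nonneg_of_pos (hu.2.2.2 o) (mul_pos hwo (hu.pos hb hconn o))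

/-- In the subcritical case, there are infinitely many linearly independent positive
superharmonic functions. -/
lemma Subcritical.exists_linearIndependent [Infinite X] {b : X → X → ℝ} (hb : IsGraph b)
    (hconn : GraphConnected b) {q : X → ℝ} (hsub : Subcritical b q) :
    ∃ u : ℕ → X → ℝ, (∀ n, IsPosSuperharmonic b q (u n)) ∧ LinearIndependent ℝ u := by
  classical
  obtain ⟨o, ho⟩ := hsub.exists_Hop_pos hb hconn
  have hstrict : ∀ x, ∃ u, IsPosSuperharmonic b q u ∧ 0 < Hop b q u x := by
    refine hconn.induction ho ?_
    rintro x y hxy ⟨u, hu, hx⟩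
    obtain ⟨ε, -, hv, hpos⟩ := hu.sub_single hb hx
    exact ⟨_, hv, hpos y hxy⟩
  obtain ⟨B, hBt, hspan, hB⟩ := _root_.exists_linearIndependent ℝ {u | IsPosSuperharmonic b q u}
  have hmem : ∀ x, (Pi.single x 1 : X → ℝ) ∈ Submodule.span ℝ B := by
    intro x
    obtain ⟨u, hu, hx⟩ := hstrict x
    obtain ⟨ε, hε, hv, -⟩ := hu.sub_single hb hx
    have hspan' : ∀ w, IsPosSuperharmonic b q w → w ∈ Submodule.span ℝ B := fun w hw =>
      hspan ▸ Submodule.subset_span hw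
    have h := Submodule.smul_mem _ ε⁻¹ (Submodule.sub_mem _ (hspan' u hu) (hspan' _ hv))
    rwa [sub_sub_cancel, ← Pi.single_smul, smul_eq_mul, inv_mul_cancel₀ hε.ne'] at h
  have hinf : B.Infinite := by
    intro hfin
    have := Module.Finite.span_of_finite ℝ hfin
    have hli : LinearIndependent ℝ fun x => (⟨Pi.single x 1, hmem x⟩ : Submodule.span ℝ B) :=
      .of_comp (Submodule.span ℝ B).subtype (Pi.linearIndependent_single_one X ℝ)
    exact not_finite_iff_infinite.2 ‹Infinite X› hli.finite
  refine ⟨fun n => (hinf.natEmbedding B n : X → ℝ), fun n => hBt (hinf.natEmbedding B n).2, ?_⟩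
  exact hB.comp _ (hinf.natEmbedding B).injective

lemma not_linearIndependent_of_forall_eq_mul {u : ℕ → X → ℝ} {c : ℝ} (h : ∀ x, u 1 x = c * u 0 x) :
    ¬ LinearIndependent ℝ u := fun hli => by
  have hpair := hli.comp ![0, 1] (by decide)
  have := LinearIndependent.pair_iff.1 (by
    convert hpair using 1
    ext i; fin_cases i <;> rfl : LinearIndependent ℝ ![u 0, u 1]) c (-1) (by
      ext x; simp [h])
  norm_num at this

/-- Criticality via uniqueness of positive superharmonic functions. -/
theorem criticality_iff_unique_superharmonic (b : X → X → ℝ) (q : X → ℝ)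
    (hX : Infinite X) (hb : IsGraph b) (hconn : GraphConnected b)
    (hpos : ∀ φ : X → ℝ, FinSupp φ → 0 ≤ hform b q φ) :
    (¬ Subcritical b q ↔
      ((∃ u : X → ℝ, MemF b u ∧ (∀ x, 0 ≤ u x) ∧ u ≠ 0 ∧ ∀ x, 0 ≤ Hop b q u x) ∧
        ∀ u v : X → ℝ,
          (MemF b u ∧ (∀ x, 0 ≤ u x) ∧ u ≠ 0 ∧ ∀ x, 0 ≤ Hop b q u x) →
          (MemF b v ∧ (∀ x, 0 ≤ v x) ∧ v ≠ 0 ∧ ∀ x, 0 ≤ Hop b q v x) →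
          ∃ c : ℝ, ∀ x, v x = c * u x)) ∧
    (¬ Subcritical b q ↔
      ¬ ∃ u : ℕ → X → ℝ,
        (∀ n, MemF b (u n) ∧ (∀ x, 0 ≤ u n x) ∧ u n ≠ 0 ∧ ∀ x, 0 ≤ Hop b q (u n) x) ∧
        LinearIndependent ℝ u) := by
  have hunique : ¬ Subcritical b q → ∀ u v, IsPosSuperharmonic b q u → IsPosSuperharmonic b q v →
      ∃ c : ℝ, ∀ x, v x = c * u x := fun hcrit u v hu hv =>
    hu.exists_eq_mul hb hconn (fun _ hw => hw.Hop_eq_zero hb hconn hcrit) hv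
  refine ⟨⟨fun hcrit => ⟨?_, hunique hcrit⟩, ?_⟩, ?_, ?_⟩
  · exact exists_isPosSuperharmonic hb hconn hpos (Classical.arbitrary X)
  · rintro ⟨-, h⟩ hsub
    obtain ⟨u, hu, hli⟩ := hsub.exists_linearIndependent hb hconn
    obtain ⟨c, hc⟩ := h (u 0) (u 1) (hu 0) (hu 1)
    exact not_linearIndependent_of_forall_eq_mul hc hli
  · rintro hcrit ⟨u, hu, hli⟩
    obtain ⟨c, hc⟩ := hunique hcrit (u 0) (u 1) (hu 0) (hu 1)
    exact not_linearIndependent_of_forall_eq_mul hc hli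
  · exact fun h hsub => h (hsub.exists_linearIndependent hb hconn)
end
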